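/- Let A = ⊕ A_n be a connected graded algebra over a field, generated in degree 1, with a_n = dim A_n finite, and suppose dim A_2 = m² + 1 for some m ≥ 1. Then the entropy H(A) = lim a_n^{1/n} satisfies H(A) ≤ m. -/

import Mathlib

open Module Filter

theorem spec_lemma {V : Type*} [Fintype V] [DecidableEq V] (B : Matrix V V ℝ)
    (hB : ∀ i j, B i j = B j i) : ∃ (l : V → ℝ) (U : V → V → ℝ),
      (∀ y : V → ℝ, ∑ i, ∑ j, y i * B i j * y j = ∑ k, l k * (∑ i, U k i * y i)^2) ∧
      (∀ y : V → ℝ, ∑ i, y i ^ 2 = ∑ k, (∑ i, U k i * y i)^2) ∧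
      ∑ k, l k ^ 2 = ∑ i, ∑ j, B i j ^ 2 := by
  have hH : B.IsHermitian := by
    ext i j; simp [Matrix.conjTranspose_apply, hB i j]
  set W : Matrix V V ℝ := (hH.eigenvectorUnitary : Matrix V V ℝ) with hW
  have hU1 : star W * W = 1 := (Matrix.mem_unitaryGroup_iff').1 hH.eigenvectorUnitary.2
  have hU2 : W * star W = 1 := (Matrix.mem_unitaryGroup_iff).1 hH.eigenvectorUnitary.2
  have hsp : B = W * Matrix.diagonal hH.eigenvalues * star W := by
    have := hH.spectral_theorem
    simpa [Unitary.conjStarAlgAut_apply] using this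
  refine ⟨hH.eigenvalues, fun k i => W i k, ?_, ?_, ?_⟩
  · intro y
    have h1 : ∑ i, ∑ j, y i * B i j * y j = y ⬝ᵥ B.mulVec y := by
      simp [dotProduct, Matrix.mulVec, Finset.mul_sum, mul_assoc]
    rw [h1]
    conv_lhs => rw [hsp]
    rw [← Matrix.mulVec_mulVec, ← Matrix.mulVec_mulVec, Matrix.dotProduct_mulVec]
    simp only [dotProduct, Matrix.mulVec_diagonal]
    refine Finset.sum_congr rfl fun k _ => ?_
    have h2 : Matrix.vecMul y W k = ∑ i, W i k * y i := by
      simp [Matrix.vecMul, dotProduct, mul_comm]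
    have h3 : (star W).mulVec y k = ∑ i, W i k * y i := by
      simp [Matrix.mulVec, dotProduct, Matrix.star_apply]
    rw [h2, h3]; ring
  · intro y
    have h1 : ∑ i, y i ^ 2 = y ⬝ᵥ (W * star W).mulVec y := by
      rw [hU2]; simp [dotProduct, sq]
    rw [h1, ← Matrix.mulVec_mulVec, Matrix.dotProduct_mulVec]
    simp only [dotProduct]
    refine Finset.sum_congr rfl fun k _ => ?_
    have h2 : Matrix.vecMul y W k = ∑ i, W i k * y i := by
      simp [Matrix.vecMul, dotProduct, mul_comm]
    have h3 : (star W).mulVec y k = ∑ i, W i k * y i := by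
      simp [Matrix.mulVec, dotProduct, Matrix.star_apply]
    rw [h2, h3]; ring
  · have h1 : ∑ i, ∑ j, B i j ^ 2 = (B * B).trace := by
      simp only [Matrix.trace, Matrix.diag, Matrix.mul_apply]
      refine Finset.sum_congr rfl fun i _ => Finset.sum_congr rfl fun j _ => ?_
      rw [hB j i]; ring
    have h2 : B * B = W * (Matrix.diagonal hH.eigenvalues * Matrix.diagonal hH.eigenvalues) * star W := by
      calc B * B = (W * Matrix.diagonal hH.eigenvalues * star W) * (W * Matrix.diagonal hH.eigenvalues * star W) := by rw [← hsp]
        _ = W * (Matrix.diagonal hH.eigenvalues * (star W * W) * Matrix.diagonal hH.eigenvalues) * star W := by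
          simp only [Matrix.mul_assoc]
        _ = _ := by rw [hU1, Matrix.mul_one]
    rw [h1, h2, Matrix.trace_mul_comm, ← Matrix.mul_assoc, hU1, Matrix.one_mul, Matrix.diagonal_mul_diagonal,
      Matrix.trace_diagonal]
    simp [sq]

/-- numerical range bound gives positive supersolution -/
theorem supersol {V : Type*} [Fintype V] [DecidableEq V] (A : Matrix V V ℝ) (hA : ∀ i j, 0 ≤ A i j)
    (r s : ℝ) (hr : 0 ≤ r) (hs : r < s)
    (hQ : ∀ y : V → ℝ, ∑ i, ∑ j, y i * A i j * y j ≤ r * ∑ i, y i ^ 2) :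
    ∃ x : V → ℝ, (∀ i, 0 < x i) ∧ ∀ i, ∑ j, A i j * x j ≤ s * x i := by
  let f : (V → ℝ) →ₗ[ℝ] (V → ℝ) := s • LinearMap.id - Matrix.mulVecLin A
  have hf : ∀ y i, f y i = s * y i - ∑ j, A i j * y j := by
    intro y i; simp [f, Matrix.mulVec, dotProduct]
  have hform : ∀ y, ∑ i, y i * f y i = s * ∑ i, y i ^ 2 - ∑ i, ∑ j, y i * A i j * y j := by
    intro y
    simp only [hf, Finset.mul_sum, mul_sub, Finset.sum_sub_distrib]
    congr 1
    · exact Finset.sum_congr rfl fun i _ => by ring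
    · exact Finset.sum_congr rfl fun i _ => Finset.sum_congr rfl fun j _ => by ring
  have hzero : ∀ y : V → ℝ, ∑ i, y i ^ 2 ≤ 0 → y = 0 := by
    intro y hy
    have h0 : ∑ i, y i ^ 2 = 0 := le_antisymm hy (Finset.sum_nonneg fun i _ => sq_nonneg _)
    rw [Finset.sum_eq_zero_iff_of_nonneg (fun i _ => sq_nonneg _)] at h0
    ext i; simpa using h0 i (Finset.mem_univ i)
  have hinj : Function.Injective f := by
    rw [injective_iff_map_eq_zero]
    intro y hy
    have h1 := hform y
    rw [hy] at h1
    have h2 := hQ y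
    apply hzero
    simp at h1
    nlinarith
  have hsurj := LinearMap.surjective_of_injective hinj
  obtain ⟨x, hx⟩ := hsurj (fun _ => 1)
  have hx' : ∀ i, s * x i - ∑ j, A i j * x j = 1 := fun i => by rw [← hf, hx]
  -- negative part
  have hneg : (fun i => max (-x i) 0) = 0 := by
    apply hzero
    have hq := hQ (fun i => max (-x i) 0)
    have key : ∀ i, max (-x i) 0 * 1 ≤ - s * (max (-x i) 0)^2 + ∑ j, max (-x i) 0 * A i j * max (-x j) 0 := by
      intro i
      have e1 : max (-x i) 0 * x i = - (max (-x i) 0)^2 := by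
        rcases le_total (-x i) 0 with h | h
        · rw [max_eq_right h]; simp
        · rw [max_eq_left h]; ring
      have e2 : - (∑ j, A i j * x j) ≤ ∑ j, A i j * max (-x j) 0 := by
        rw [← Finset.sum_neg_distrib]
        refine Finset.sum_le_sum fun j _ => ?_
        have := mul_le_mul_of_nonneg_left (le_max_left (-x j) 0) (hA i j)
        linarith
      have e3 : 0 ≤ max (-x i) 0 := le_max_right _ _
      have e4 : ∑ j, max (-x i) 0 * A i j * max (-x j) 0 = max (-x i) 0 * ∑ j, A i j * max (-x j) 0 := by
        rw [Finset.mul_sum]; exact Finset.sum_congr rfl fun j _ => by ring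
      rw [e4, ← hx' i]
      have := mul_le_mul_of_nonneg_left e2 e3
      nlinarith
    have k2 := Finset.sum_le_sum (fun i (_ : i ∈ Finset.univ) => key i)
    rw [Finset.sum_add_distrib, ← Finset.mul_sum] at k2
    have k3 : 0 ≤ ∑ i, max (-x i) 0 * 1 := Finset.sum_nonneg fun i _ => by
      simp
    nlinarith
  have hxn : ∀ i, 0 ≤ x i := by
    intro i
    have := congrFun hneg i
    simp at this
    exact this
  have hspos : 0 < s := by linarith
  refine ⟨x, fun i => ?_, fun i => by linarith [hx' i]⟩
  have h1 : 0 ≤ ∑ j, A i j * x j := Finset.sum_nonneg fun j _ => mul_nonneg (hA i j) (hxn j)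
  have h2 := hx' i
  by_contra h
  have : x i = 0 := le_antisymm (not_lt.1 h) (hxn i)
  rw [this] at h2; linarith

theorem spec_two {V : Type*} [Fintype V] [DecidableEq V] (B : Matrix V V ℝ)
    (hB : ∀ i j, B i j = B j i) (r : ℝ)
    (hy : ∃ y : V → ℝ, r * ∑ i, y i ^ 2 < ∑ i, ∑ j, y i * B i j * y j) :
    ∃ (l : V → ℝ) (i0 : V) (v : V → ℝ), r < l i0 ∧ ∑ k, l k ^ 2 = ∑ i, ∑ j, B i j ^ 2 ∧
      (∀ (y : V → ℝ) (c : ℝ), 0 < ∑ i, y i ^ 2 →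
        ∑ i, ∑ j, y i * B i j * y j ≤ - c * ∑ i, y i ^ 2 → ∃ k, l k ≤ - c) ∧
      (∀ (y : V → ℝ) (c : ℝ), 0 < ∑ i, y i ^ 2 → ∑ i, v i * y i = 0 →
        c * ∑ i, y i ^ 2 ≤ ∑ i, ∑ j, y i * B i j * y j → ∃ k, k ≠ i0 ∧ c ≤ l k) := by
  obtain ⟨l, U, h1, h2, h3⟩ := spec_lemma B hB
  obtain ⟨y, hy⟩ := hy
  have : ∃ i0, r < l i0 := by
    by_contra hc
    push Not at hc
    rw [h1, h2, Finset.mul_sum] at hy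
    exact absurd hy (not_lt.2 (Finset.sum_le_sum fun k _ =>
      mul_le_mul_of_nonneg_right (hc k) (sq_nonneg _)))
  obtain ⟨i0, hi0⟩ := this
  refine ⟨l, i0, U i0, hi0, h3, ?_, ?_⟩
  · intro y c hpos hle
    by_contra hc
    push Not at hc
    rw [h1, h2, Finset.mul_sum] at hle
    rw [h2] at hpos
    obtain ⟨k, -, hk⟩ := Finset.exists_lt_of_sum_lt (f := fun _ => (0:ℝ)) (by simpa using hpos)
    have : ∑ k, -c * (∑ i, U k i * y i)^2 < ∑ k, l k * (∑ i, U k i * y i)^2 :=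
      Finset.sum_lt_sum (fun k _ => mul_le_mul_of_nonneg_right (hc k).le (sq_nonneg _))
        ⟨k, Finset.mem_univ _, mul_lt_mul_of_pos_right (hc k) hk⟩
    linarith
  · intro y c hpos horth hle
    by_contra hc
    push Not at hc
    rw [h1, h2, Finset.mul_sum] at hle
    rw [h2] at hpos
    obtain ⟨k, -, hk⟩ := Finset.exists_lt_of_sum_lt (f := fun _ => (0:ℝ)) (by simpa using hpos)
    have hk0 : k ≠ i0 := by
      rintro rfl
      rw [horth] at hk; simp at hk
    have : ∑ k, l k * (∑ i, U k i * y i)^2 < ∑ k, c * (∑ i, U k i * y i)^2 := by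
      refine Finset.sum_lt_sum (fun k _ => ?_)
        ⟨k, Finset.mem_univ _, mul_lt_mul_of_pos_right (hc k hk0) hk⟩
      by_cases h : k = i0
      · subst h; rw [horth]; simp
      · exact mul_le_mul_of_nonneg_right (hc k h).le (sq_nonneg _)
    linarith

theorem form_three {V : Type*} [Fintype V] [DecidableEq V] (B : Matrix V V ℝ) (i j k : V)
    (hij : i ≠ j) (hik : i ≠ k) (hjk : j ≠ k) (a b c : ℝ) (y : V → ℝ)
    (hy : y = Pi.single i a + Pi.single j b + Pi.single k c) :
    ∑ i, ∑ j, y i * B i j * y j = a ^ 2 * B i i + b ^ 2 * B j j + c ^ 2 * B k k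
      + a * b * (B i j + B j i) + a * c * (B i k + B k i) + b * c * (B j k + B k j) ∧
    ∑ i, y i ^ 2 = a ^ 2 + b ^ 2 + c ^ 2 := by
  have h1 : ∑ i, ∑ j, y i * B i j * y j = y ⬝ᵥ B.mulVec y := by
    simp [dotProduct, Matrix.mulVec, Finset.mul_sum, mul_assoc]
  have h2 : ∑ i, y i ^ 2 = y ⬝ᵥ y := by simp [dotProduct, sq]
  rw [h1, h2, hy]
  constructor
  · simp only [Matrix.mulVec_add, add_dotProduct, dotProduct_add, single_dotProduct, Matrix.mulVec_single]
    simp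
    ring
  · simp only [add_dotProduct, dotProduct_add, single_dotProduct]
    simp [hij, hik, hjk, hij.symm, hik.symm, hjk.symm]
    ring

theorem form_two {V : Type*} [Fintype V] [DecidableEq V] (B : Matrix V V ℝ) (i j : V)
    (hij : i ≠ j) (a b : ℝ) (y : V → ℝ)
    (hy : y = Pi.single i a + Pi.single j b) :
    ∑ i, ∑ j, y i * B i j * y j = a ^ 2 * B i i + b ^ 2 * B j j 
      + a * b * (B i j + B j i)  ∧
    ∑ i, y i ^ 2 = a ^ 2 + b ^ 2 := by
  have h1 : ∑ i, ∑ j, y i * B i j * y j = y ⬝ᵥ B.mulVec y := by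
    simp [dotProduct, Matrix.mulVec, Finset.mul_sum, mul_assoc]
  have h2 : ∑ i, y i ^ 2 = y ⬝ᵥ y := by simp [dotProduct, sq]
  rw [h1, h2, hy]
  constructor
  · simp only [Matrix.mulVec_add, add_dotProduct, dotProduct_add, single_dotProduct, Matrix.mulVec_single]
    simp
    ring
  · simp only [add_dotProduct, dotProduct_add, single_dotProduct]
    simp [hij, hij.symm]
    ring

/-- facts about symmetric matrices with large top of the form -/
theorem spec_facts {V : Type*} [Fintype V] [DecidableEq V] (B : Matrix V V ℝ)
    (hB : ∀ i j, B i j = B j i) (r : ℝ) (hr : 0 ≤ r)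
    (hy : ∃ y : V → ℝ, r * ∑ i, y i ^ 2 < ∑ i, ∑ j, y i * B i j * y j)
    (hF : ∑ i, ∑ j, B i j ^ 2 ≤ r ^ 2 + 1) :
    (∀ i j, i ≠ j → B i i = 1 → B j j = 1 → B i j ≠ 0) ∧
    (∀ i j, i ≠ j → B i i = 0 → B j j = 0 → B i j ≠ 1) ∧
    (∀ i j k, i ≠ j → i ≠ k → j ≠ k → B i i = 1 → B j j = 0 → B k k = 0 →
      B i j = 1 → B i k = 1 → B j k ≠ 0) ∧
    (∀ i j, i ≠ j → B i i = 1 → B j j = 1 → B i j = 1/2 →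
      ∑ i, ∑ j, B i j ^ 2 ≤ r ^ 2 + 1/2 →
      ∀ p q, p ≠ q → B p p = 1 → B q q = 0 → B p q ≠ 1) := by
  obtain ⟨l, i0, v, h0, hsum, hneg, hpos⟩ := spec_two B hB r hy
  rw [← hsum] at hF ⊢
  have hl0 : r ^ 2 < l i0 ^ 2 := by nlinarith
  have htwo : ∀ k, k ≠ i0 → l i0 ^ 2 + l k ^ 2 ≤ ∑ k, l k ^ 2 := by
    intro k hk
    rw [← Finset.sum_pair (f := fun k => l k ^ 2) hk.symm]
    exact Finset.sum_le_sum_of_subset_of_nonneg (Finset.subset_univ _) fun _ _ _ => sq_nonneg _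
  have hthree : ∀ k j, k ≠ i0 → j ≠ i0 → j ≠ k → l i0 ^ 2 + (l j ^ 2 + l k ^ 2) ≤ ∑ k, l k ^ 2 := by
    intro k j hk hj hjk
    rw [← Finset.sum_pair (f := fun k => l k ^ 2) hjk,
      ← Finset.sum_insert (f := fun k => l k ^ 2) (a := i0) (by simp [hk.symm, hj.symm])]
    exact Finset.sum_le_sum_of_subset_of_nonneg (Finset.subset_univ _) fun _ _ _ => sq_nonneg _
  have hnegone : ¬ ∃ k, l k ≤ - 1 := by
    rintro ⟨k, hk⟩
    have : k ≠ i0 := by rintro rfl; linarith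
    have := htwo k this
    nlinarith
  have hpair : ∀ i j (b : ℝ), i ≠ j → B i i = 1 → B j j = 1 → B i j = b → 0 ≤ b →
      ∃ k, k ≠ i0 ∧ 1 - b ≤ l k := by
    intro i j b hij hi hj hb hb0
    by_cases hv : v i = 0 ∧ v j = 0
    · obtain ⟨f1, f2⟩ := form_two B i j hij 1 0 _ rfl
      refine hpos (Pi.single i 1 + Pi.single j 0) (1 - b) ?_ ?_ ?_
      · rw [f2]; norm_num
      · simp [Pi.single_apply, hv.1]
      · rw [f1, f2, hi]; linarith
    · obtain ⟨f1, f2⟩ := form_two B i j hij (v j) (-v i) _ rfl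
      refine hpos (Pi.single i (v j) + Pi.single j (-v i)) (1 - b) ?_ ?_ ?_
      · rw [f2]
        by_contra hc
        apply hv
        constructor <;> nlinarith [sq_nonneg (v i), sq_nonneg (v j)]
      · simp [Pi.single_apply, mul_add, Finset.sum_add_distrib]; ring
      · rw [f1, f2, hi, hj, hB j i, hb]
        nlinarith [mul_nonneg hb0 (sq_nonneg (v i - v j))]
  refine ⟨?_, ?_, ?_, ?_⟩
  · intro i j hij hi hj h
    obtain ⟨k, hk, hk1⟩ := hpair i j 0 hij hi hj h le_rfl
    have := htwo k hk
    nlinarith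
  · intro i j hij hi hj h
    obtain ⟨f1, f2⟩ := form_two B i j hij 1 (-1) _ rfl
    refine hnegone (hneg (Pi.single i 1 + Pi.single j (-1)) 1 (by rw [f2]; norm_num) ?_)
    rw [f1, f2, hi, hj, hB j i, h]; norm_num
  · intro i j k hij hik hjk hi hj hk h1 h2 h3
    obtain ⟨f1, f2⟩ := form_three B i j k hij hik hjk 1 (-1) (-1) _ rfl
    refine hnegone (hneg (Pi.single i 1 + Pi.single j (-1) + Pi.single k (-1)) 1 (by rw [f2]; norm_num) ?_)
    rw [f1, f2, hi, hj, hk, hB j i, hB k i, hB k j, h1, h2, h3]; norm_num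
  · intro i j hij hi hj h hF2 p q hpq hp hq hpq1
    obtain ⟨k, hk, hk1⟩ := hpair i j (1/2) hij hi hj h (by norm_num)
    obtain ⟨f1, f2⟩ := form_two B p q hpq 1 (-8/5) _ rfl
    obtain ⟨k', hk'⟩ := hneg (Pi.single p 1 + Pi.single q (-8/5)) (3/5) (by rw [f2]; norm_num) (by
      rw [f1, f2, hp, hq, hB q p, hpq1]; norm_num)
    have hk0 : k' ≠ i0 := by rintro rfl; linarith
    have hkk : k' ≠ k := by rintro rfl; linarith
    have := hthree k k' hk hk0 hkk
    nlinarith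

theorem spec_frob {V : Type*} [Fintype V] [DecidableEq V] (B : Matrix V V ℝ)
    (hB : ∀ i j, B i j = B j i) (r : ℝ) (hr : 0 ≤ r)
    (hy : ∃ y : V → ℝ, r * ∑ i, y i ^ 2 < ∑ i, ∑ j, y i * B i j * y j) :
    r ^ 2 < ∑ i, ∑ j, B i j ^ 2 := by
  obtain ⟨l, i0, v, h0, hsum, -, -⟩ := spec_two B hB r hy
  rw [← hsum]
  have := Finset.single_le_sum (f := fun k => l k ^ 2) (fun _ _ => sq_nonneg _) (Finset.mem_univ i0)
  nlinarith

theorem special_supersol {V : Type*} [Fintype V] [DecidableEq V] (E : V → V → Prop)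
    [DecidableRel E] (m : ℕ) (hm : 1 ≤ m) (s : ℝ) (hs : (m : ℝ) < s) (p q : V) (hpq : p ≠ q)
    (hnot : ¬ (E p p ∧ E q q))
    (hd : (Finset.univ.filter (fun i => E i i)).card = m)
    (hE : ∀ i j, E i j → (E i i ∧ E j j) ∨ (i = p ∧ j = q)) :
    ∃ x : V → ℝ, (∀ i, 0 < x i) ∧ ∀ i, ∑ j, (if E i j then (1:ℝ) else 0) * x j ≤ s * x i := by
  have hm1 : (1:ℝ) ≤ m := by exact_mod_cast hm
  set x : V → ℝ := fun i => if E i i ∨ i = p then 1 else min 1 (s - m) with hx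
  have hx1 : ∀ i, x i ≤ 1 := by
    intro i; simp only [hx]; split_ifs
    · exact le_rfl
    · exact min_le_left _ _
  have hx0 : ∀ i, 0 < x i := by
    intro i; simp only [hx]; split_ifs
    · exact one_pos
    · exact lt_min one_pos (by linarith)
  refine ⟨x, hx0, fun i => ?_⟩
  have hle : ∑ j, (if E i j then (1:ℝ) else 0) * x j ≤
      ∑ j, ((if E i i then (if E j j then (1:ℝ) else 0) else 0) + (if j = q then (if i = p then x q else 0) else 0)) := by
    refine Finset.sum_le_sum fun j _ => ?_
    have h1 := hx1 j
    have h0 := hx0 j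
    have h0q := hx0 q
    by_cases hij : E i j
    · rcases hE i j hij with ⟨hi, hj⟩ | ⟨rfl, rfl⟩
      · simp only [hij, hi, hj, if_true]
        have : 0 ≤ (if j = q then (if i = p then x q else 0) else 0) := by split_ifs <;> linarith
        linarith
      · simp only [hij, if_true]
        have : 0 ≤ (if E i i then (if E j j then (1:ℝ) else 0) else 0) := by split_ifs <;> linarith
        linarith
    · simp only [hij, if_false, zero_mul]
      have : 0 ≤ (if j = q then (if i = p then x q else 0) else 0) := by split_ifs <;> linarith
      have : 0 ≤ (if E i i then (if E j j then (1:ℝ) else 0) else 0) := by split_ifs <;> linarith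
      linarith
  refine hle.trans ?_
  rw [Finset.sum_add_distrib, Finset.sum_ite_eq' ]
  simp only [Finset.mem_univ, if_true]
  have hsum : ∑ j, (if E i i then (if E j j then (1:ℝ) else 0) else 0) = if E i i then (m:ℝ) else 0 := by
    by_cases h : E i i
    · simp only [h, if_true, Finset.sum_boole, hd]
    · simp [h]
  rw [hsum]
  by_cases hi : E i i
  · have hxi : x i = 1 := by simp [hx, hi]
    rw [hxi]
    by_cases hip : i = p
    · subst hip
      have hq : ¬ E q q := fun h => hnot ⟨hi, h⟩
      have : x q ≤ s - m := by simp [hx, hq, hpq.symm]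
      simp only [hi, if_true]; linarith
    · simp only [hi, hip, if_true, if_false]; linarith
  · by_cases hip : i = p
    · have hxi : x i = 1 := by simp [hx, hip]
      rw [hxi]
      simp only [hip, if_true]
      rw [← hip]
      simp only [hi, if_false]
      linarith [hx1 q]
    · simp only [hi, hip, if_false]
      have := hx0 i
      nlinarith

theorem graph_supersol {V : Type*} [Fintype V] [DecidableEq V] (E : V → V → Prop)
    [DecidableRel E] (m : ℕ) (hm : 1 ≤ m) (s : ℝ) (hs : (m : ℝ) < s)
    (hcard : ∑ i, ∑ j, (if E i j then (1:ℤ) else 0) ≤ m ^ 2 + 1) :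
    ∃ x : V → ℝ, (∀ i, 0 < x i) ∧ ∀ i, ∑ j, (if E i j then (1:ℝ) else 0) * x j ≤ s * x i := by
  set a : V → V → ℤ := fun i j => if E i j then 1 else 0 with ha
  have ha01 : ∀ i j, a i j = 0 ∨ a i j = 1 := by
    intro i j; simp only [ha]; split_ifs <;> simp
  have haR : ∀ i j, (if E i j then (1:ℝ) else 0) = (a i j : ℝ) := by
    intro i j; simp only [ha]; split_ifs <;> simp
  have haE : ∀ i j, a i j = 1 ↔ E i j := by
    intro i j; simp only [ha]; split_ifs <;> simp [*]
  have haE0 : ∀ i j, a i j = 0 ↔ ¬ E i j := by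
    intro i j; simp only [ha]; split_ifs <;> simp [*]
  simp only [haR]
  change ∑ i, ∑ j, a i j ≤ _ at hcard
  set n : V → V → ℤ := fun i j => a i j * (1 - a j i) with hn
  have hn01 : ∀ i j, n i j = 0 ∨ n i j = 1 := by
    intro i j; simp only [hn]
    rcases ha01 i j with h | h <;> rcases ha01 j i with h' | h' <;> simp [h, h']
  set B : Matrix V V ℝ := fun i j => ((a i j : ℝ) + a j i) / 2 with hBdef
  have hB : ∀ i j, B i j = B j i := fun i j => by simp only [hBdef]; ring
  have hform : ∀ y : V → ℝ, ∑ i, ∑ j, y i * B i j * y j = ∑ i, ∑ j, y i * (a i j : ℝ) * y j := by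
    intro y
    have e1 : ∑ i, ∑ j, y i * (a j i : ℝ) * y j = ∑ i, ∑ j, y i * (a i j : ℝ) * y j := by
      rw [Finset.sum_comm]
      exact Finset.sum_congr rfl fun i _ => Finset.sum_congr rfl fun j _ => by ring
    have e2 : ∑ i, ∑ j, y i * B i j * y j = (∑ i, ∑ j, y i * (a i j : ℝ) * y j + ∑ i, ∑ j, y i * (a j i : ℝ) * y j) / 2 := by
      simp only [← Finset.sum_add_distrib, Finset.sum_div]
      exact Finset.sum_congr rfl fun i _ => Finset.sum_congr rfl fun j _ => by
        simp only [hBdef]; ring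
    rw [e2, e1]; ring
  by_cases hQ : ∀ y : V → ℝ, ∑ i, ∑ j, y i * (a i j : ℝ) * y j ≤ m * ∑ i, y i ^ 2
  · refine supersol (fun i j => (a i j : ℝ)) (fun i j => ?_) m s (Nat.cast_nonneg m) hs hQ
    rcases ha01 i j with h | h <;> simp [h]
  have hy : ∃ y : V → ℝ, (m:ℝ) * ∑ i, y i ^ 2 < ∑ i, ∑ j, y i * B i j * y j := by
    push Not at hQ
    obtain ⟨y, hy⟩ := hQ
    exact ⟨y, by rw [hform]; exact hy⟩
  set e : ℤ := ∑ i, ∑ j, a i j with he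
  set t : ℤ := ∑ i, ∑ j, n i j with ht
  have hfrob : ∑ i, ∑ j, B i j ^ 2 = e - t / 2 := by
    have e1 : ∑ i, ∑ j, (a j i : ℝ) = e := by
      rw [Finset.sum_comm, he]; push_cast; rfl
    have e1' : ∑ i, ∑ j, (a i j : ℝ) = e := by
      rw [he]; push_cast; rfl
    have e2 : ∑ i, ∑ j, (n j i : ℝ) = t := by
      rw [Finset.sum_comm, ht]; push_cast; rfl
    have e2' : ∑ i, ∑ j, (n i j : ℝ) = t := by
      rw [ht]; push_cast; rfl
    have e3 : ∑ i, ∑ j, B i j ^ 2 = ∑ i, ∑ j, (((a i j : ℝ) + a j i) / 2 - ((n i j : ℝ) + n j i) / 4) := by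
      refine Finset.sum_congr rfl fun i _ => Finset.sum_congr rfl fun j _ => ?_
      simp only [hBdef, hn]
      rcases ha01 i j with h | h <;> rcases ha01 j i with h' | h' <;> simp [h, h'] <;> norm_num
    rw [e3]
    simp only [Finset.sum_sub_distrib, Finset.sum_add_distrib, ← Finset.sum_div]
    rw [e1, e1', e2, e2']; ring
  have ht0 : 0 ≤ t := Finset.sum_nonneg fun i _ => Finset.sum_nonneg fun j _ => by
    rcases hn01 i j with h | h <;> simp [h]
  have hgt := spec_frob B hB m (Nat.cast_nonneg m) hy
  rw [hfrob] at hgt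
  have hgt' : 2 * (m:ℤ)^2 < 2 * e - t := by
    have : 2 * (m:ℝ)^2 < 2 * e - t := by linarith
    exact_mod_cast this
  have he1 : e = m ^ 2 + 1 := by linarith
  have ht1 : t ≤ 1 := by linarith
  have hF : ∑ i, ∑ j, B i j ^ 2 ≤ (m:ℝ) ^ 2 + 1 := by
    rw [hfrob, he1]; push_cast
    have : (0:ℝ) ≤ t := by exact_mod_cast ht0
    linarith
  obtain ⟨F1, F2, F3, F4⟩ := spec_facts B hB m (Nat.cast_nonneg m) hy hF
  have hBd : ∀ i, B i i = a i i := fun i => by simp only [hBdef]; ring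
  have G1 : ∀ i j, a i i = 1 → a j j = 1 → a i j = 0 → a j i = 1 := by
    intro i j hi hj hij
    have hne : i ≠ j := by rintro rfl; omega
    have := F1 i j hne (by simp [hBd, hi]) (by simp [hBd, hj])
    rcases ha01 j i with h | h
    · exact absurd (by simp [hBdef, hij, h]) this
    · exact h
  have G2 : ∀ i j, a i i = 0 → a j j = 0 → a i j = 1 → a j i = 0 := by
    intro i j hi hj hij
    have hne : i ≠ j := by rintro rfl; omega
    have := F2 i j hne (by simp [hBd, hi]) (by simp [hBd, hj])
    rcases ha01 j i with h | h
    · exact h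
    · exact absurd (by simp [hBdef, hij, h]) this
  set d : ℤ := ∑ i, a i i with hd
  set b : ℤ := ∑ i, ∑ j, a i i * (1 - a j j) * a i j * a j i with hb
  set c : ℤ := ∑ i, ∑ j, a i i * a j j * n i j with hc
  have hcount : e = d ^ 2 + 2 * b + t - 2 * c := by
    have k1 : ∑ i, ∑ j, (a i j + a j i) = ∑ i, ∑ j, (2 * (a i i * a j j)
        + 2 * (a i i * (1 - a j j) * a i j * a j i + a j j * (1 - a i i) * a j i * a i j)
        + (n i j + n j i) - 2 * (a i i * a j j * n i j + a j j * a i i * n j i)) := by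
      refine Finset.sum_congr rfl fun i _ => Finset.sum_congr rfl fun j _ => ?_
      have g1 := G1 i j
      have g2 := G2 i j
      simp only [hn]
      rcases ha01 i j with h | h <;> rcases ha01 j i with h' | h' <;>
        rcases ha01 i i with h'' | h'' <;> rcases ha01 j j with h''' | h''' <;>
        simp [h, h', h'', h'''] at g1 g2 ⊢
    have sw : ∀ f : V → V → ℤ, ∑ i, ∑ j, f j i = ∑ i, ∑ j, f i j := fun f => Finset.sum_comm
    simp only [Finset.sum_sub_distrib, Finset.sum_add_distrib, ← Finset.mul_sum] at k1
    have s1 := sw a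
    have s2 := sw n
    have s3 := sw (fun i j => a i i * (1 - a j j) * a i j * a j i)
    have s4 := sw (fun i j => a i i * a j j * n i j)
    have s5 : ∑ i, a i i * ∑ j, a j j = d ^ 2 := by rw [← Finset.sum_mul]; ring
    rw [s1, s2, s3, s4, s5] at k1
    linarith
  have hb0 : ∀ i j, 0 ≤ a i i * (1 - a j j) * a i j * a j i := by
    intro i j
    rcases ha01 i j with h | h <;> rcases ha01 j i with h' | h' <;>
        rcases ha01 i i with h'' | h'' <;> rcases ha01 j j with h''' | h''' <;>
        simp [h, h', h'', h''']
  have hbn : 0 ≤ b := Finset.sum_nonneg fun i _ => Finset.sum_nonneg fun j _ => hb0 i j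
  have hd0 : 0 ≤ d := Finset.sum_nonneg fun i _ => by rcases ha01 i i with h | h <;> simp [h]
  have hc0 : ∀ i j, 0 ≤ a i i * a j j * n i j ∧ a i i * a j j * n i j ≤ n i j := by
    intro i j
    rcases hn01 i j with h | h <;>
        rcases ha01 i i with h'' | h'' <;> rcases ha01 j j with h''' | h''' <;>
        simp [h, h'', h''']
  have hcn : 0 ≤ c := Finset.sum_nonneg fun i _ => Finset.sum_nonneg fun j _ => (hc0 i j).1
  have hct : c ≤ t := Finset.sum_le_sum fun i _ => Finset.sum_le_sum fun j _ => (hc0 i j).2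
  have hpairsum : t = ∑ p : V × V, n p.1 p.2 := by
    rw [ht, Fintype.sum_prod_type]
  have hnn : ∀ i j, 0 ≤ n i j := fun i j => by rcases hn01 i j with h | h <;> simp [h]
  have hN : ∀ i j k l, n i j = 1 → n k l = 1 → i = k ∧ j = l := by
    intro i j k l h1 h2
    by_contra hcon
    have hne : (i, j) ≠ (k, l) := by
      intro h; exact hcon (by simpa using h)
    have h3 := Finset.sum_le_sum_of_subset_of_nonneg (f := fun p : V × V => n p.1 p.2)
      (Finset.subset_univ {(i, j), (k, l)}) (fun p _ _ => hnn p.1 p.2)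
    rw [Finset.sum_pair hne, ← hpairsum] at h3
    simp only [h1, h2] at h3
    omega
  have hle_t : ∀ i j, n i j ≤ t := by
    intro i j
    rw [hpairsum]
    exact Finset.single_le_sum (f := fun p : V × V => n p.1 p.2) (fun p _ => hnn p.1 p.2)
      (Finset.mem_univ (i, j))
  have G3 : ∀ i j k, j ≠ k → a i i = 1 → a j j = 0 → a k k = 0 → a i j = 1 → a j i = 1 →
      a i k = 1 → a k i = 1 → n j k = 1 ∨ n k j = 1 := by
    intro i j k hjk hi hj hk h1 h2 h3 h4
    have hij : i ≠ j := by rintro rfl; omega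
    have hik : i ≠ k := by rintro rfl; omega
    have := F3 i j k hij hik hjk (by simp [hBd, hi]) (by simp [hBd, hj]) (by simp [hBd, hk])
      (by simp [hBdef, h1, h2]) (by simp [hBdef, h3, h4])
    have g := G2 j k hj hk
    rcases ha01 j k with h | h <;> rcases ha01 k j with h' | h'
    · exact absurd (by simp [hBdef, h, h']) this
    · right; simp [hn, h, h']
    · left; simp [hn, h, h']
    · rw [g h] at h'; omega
  -- degree bound
  have hdeg : b ≤ d * (1 + t) := by
    rw [hb, hd, Finset.sum_mul]
    refine Finset.sum_le_sum fun i _ => ?_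
    rcases ha01 i i with hi | hi
    · simp [hi]
    have hT : ∑ j, a i i * (1 - a j j) * a i j * a j i =
        ((Finset.univ.filter (fun j => a j j = 0 ∧ a i j = 1 ∧ a j i = 1)).card : ℤ) := by
      rw [← Finset.sum_boole]
      refine Finset.sum_congr rfl fun j _ => ?_
      rcases ha01 i j with h | h <;> rcases ha01 j i with h' | h' <;>
        rcases ha01 j j with h3 | h3 <;> simp [h, h', hi, h3]
    rw [hT, hi]
    rcases (show t = 0 ∨ t = 1 by omega) with h0 | h1
    · have : (Finset.univ.filter (fun j => a j j = 0 ∧ a i j = 1 ∧ a j i = 1)).card ≤ 1 := by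
        rw [Finset.card_le_one]
        intro j hj k hk
        simp only [Finset.mem_filter, Finset.mem_univ, true_and] at hj hk
        by_contra hne
        have := hle_t j k
        have := hle_t k j
        rcases G3 i j k hne hi hj.1 hk.1 hj.2.1 hj.2.2 hk.2.1 hk.2.2 with h | h <;> omega
      omega
    · have : (Finset.univ.filter (fun j => a j j = 0 ∧ a i j = 1 ∧ a j i = 1)).card ≤ 2 := by
        by_contra hcon
        rw [not_le, Finset.two_lt_card] at hcon
        obtain ⟨x, hx, y, hy', z, hz, hxy, hxz, hyz⟩ := hcon
        simp only [Finset.mem_filter, Finset.mem_univ, true_and] at hx hy' hz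
        rcases G3 i x y hxy hi hx.1 hy'.1 hx.2.1 hx.2.2 hy'.2.1 hy'.2.2 with h | h <;>
        rcases G3 i x z hxz hi hx.1 hz.1 hx.2.1 hx.2.2 hz.2.1 hz.2.2 with h' | h' <;>
        obtain ⟨r1, r2⟩ := hN _ _ _ _ h h'
        · exact hyz r2
        · exact hxz r1
        · exact hxy r1.symm
        · exact hyz r1
      omega
  have hm' : (1:ℤ) ≤ m := by exact_mod_cast hm
  have hcases : (t = 1 ∧ c = 0 ∧ d = m ∧ b = 0) ∨ (t = 1 ∧ c = 1 ∧ 1 ≤ b) := by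
    rw [he1] at hcount
    rcases (show t = 0 ∨ t = 1 by omega) with h0 | h1
    · exfalso
      have hc' : c = 0 := by omega
      rw [h0, hc'] at hcount
      rw [h0] at hdeg
      have h1 : d ≤ m := by nlinarith
      rcases eq_or_lt_of_le h1 with h | h
      · rw [h] at hcount; omega
      · nlinarith
    · rcases (show c = 0 ∨ c = 1 by omega) with hc' | hc'
      · left
        rw [h1, hc'] at hcount
        rw [h1] at hdeg
        have h2 : d ≤ m := by nlinarith
        have h3 : (m : ℤ) < d + 2 := by nlinarith
        have h4 : d ≠ m - 1 := by
          intro h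
          have : (m:ℤ)^2 - (m-1)^2 = 2 * m - 1 := by ring
          rw [h] at hcount
          omega
        have h5 : d = m := by omega
        refine ⟨h1, hc', h5, ?_⟩
        rw [h5] at hcount; omega
      · right
        refine ⟨h1, hc', ?_⟩
        by_contra hcon
        have hb' : b = 0 := by omega
        rw [h1, hc', hb'] at hcount
        have : (m:ℤ) < d := by nlinarith
        nlinarith
  rcases hcases with ⟨h1, h2, h3, h4⟩ | ⟨h1, h2, h3⟩
  · have hex : ∃ p q, n p q = 1 := by
      by_contra hcon
      push Not at hcon
      have : t = 0 := Finset.sum_eq_zero fun i _ => Finset.sum_eq_zero fun j _ =>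
        (hn01 i j).resolve_right (hcon i j)
      omega
    obtain ⟨p, q, hpq⟩ := hex
    have hbz : ∀ i j, a i i * (1 - a j j) * a i j * a j i = 0 := by
      intro i j
      have := (Finset.sum_eq_zero_iff_of_nonneg
        (fun i _ => Finset.sum_nonneg fun j _ => hb0 i j)).1 h4 i (Finset.mem_univ i)
      exact (Finset.sum_eq_zero_iff_of_nonneg (fun j _ => hb0 i j)).1 this j (Finset.mem_univ j)
    have hcz : a p p * a q q * n p q = 0 := by
      have := (Finset.sum_eq_zero_iff_of_nonneg
        (fun i _ => Finset.sum_nonneg fun j _ => (hc0 i j).1)).1 h2 p (Finset.mem_univ p)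
      exact (Finset.sum_eq_zero_iff_of_nonneg (fun j _ => (hc0 p j).1)).1 this q (Finset.mem_univ q)
    have hne : p ≠ q := by
      rintro rfl
      rcases ha01 p p with h | h <;> simp [hn, h] at hpq
    have := special_supersol E m hm s hs p q hne ?_ ?_ ?_
    · simpa only [haR] using this
    · rintro ⟨hp, hq⟩
      rw [(haE p p).2 hp, (haE q q).2 hq, hpq] at hcz
      omega
    · have : ((Finset.univ.filter (fun i => E i i)).card : ℤ) = m := by
        rw [← h3, hd, ← Finset.sum_boole]
      exact_mod_cast this
    · intro i j hij
      rw [← haE, ← haE]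
      rw [← haE] at hij
      by_contra hcon
      push Not at hcon
      have z1 := hbz i j
      have z2 := hbz j i
      have g2 := G2 i j
      have hnij : n i j ≠ 1 := by
        intro h
        obtain ⟨r1, r2⟩ := hN _ _ _ _ h hpq
        exact hcon.2 r1 r2
      rcases ha01 j i with h5 | h5 <;>
        rcases ha01 i i with h6 | h6 <;> rcases ha01 j j with h7 | h7 <;>
        simp [hn, hij, h5, h6, h7] at g2 z1 z2 hnij hcon
  · exfalso
    have hex : ∃ p q, a p p * a q q * n p q ≠ 0 := by
      by_contra hcon
      push Not at hcon
      have : c = 0 := Finset.sum_eq_zero fun i _ => Finset.sum_eq_zero fun j _ => hcon i j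
      omega
    have hex2 : ∃ i j, a i i * (1 - a j j) * a i j * a j i ≠ 0 := by
      by_contra hcon
      push Not at hcon
      have : b = 0 := Finset.sum_eq_zero fun i _ => Finset.sum_eq_zero fun j _ => hcon i j
      omega
    obtain ⟨p, q, hpq⟩ := hex
    obtain ⟨i, j, hij⟩ := hex2
    have hp : a p p = 1 := (ha01 p p).resolve_left fun h => hpq (by simp [h])
    have hq : a q q = 1 := (ha01 q q).resolve_left fun h => hpq (by simp [h])
    have hnpq : n p q = 1 := (hn01 p q).resolve_left fun h => hpq (by simp [h])
    have hapq : a p q = 1 := (ha01 p q).resolve_left fun h => by simp [hn, h] at hnpq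
    have haqp : a q p = 0 := (ha01 q p).resolve_right fun h => by simp [hn, h] at hnpq
    have hi : a i i = 1 := (ha01 i i).resolve_left fun h => hij (by simp [h])
    have hj : a j j = 0 := (ha01 j j).resolve_right fun h => hij (by simp [h])
    have haij : a i j = 1 := (ha01 i j).resolve_left fun h => hij (by simp [h])
    have haji : a j i = 1 := (ha01 j i).resolve_left fun h => hij (by simp [h])
    have hne : p ≠ q := by rintro rfl; omega
    have hne2 : i ≠ j := by rintro rfl; omega
    refine F4 p q hne (by simp [hBd, hp]) (by simp [hBd, hq]) (by simp [hBdef, hapq, haqp]) ?_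
      i j hne2 (by simp [hBd, hi]) (by simp [hBd, hj]) (by simp [hBdef, haij, haji])
    rw [hfrob, he1, h1]; push_cast; linarith

theorem linIndep_of_key {F M ι : Type*} [Field F] [AddCommGroup M] [Module F M] (u : ι → M)
    (g : ι → ℕ) (hg : Function.Injective g)
    (h : ∀ i, u i ∉ Submodule.span F (u '' {j | g j < g i})) : LinearIndependent F u := by
  classical
  rw [linearIndependent_iff']
  intro s c hc
  by_contra hcon
  push Not at hcon
  obtain ⟨i, hi, hci⟩ := hcon
  obtain ⟨i0, hi0, hmax⟩ := Finset.exists_max_image (s.filter (fun i => c i ≠ 0)) g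
    ⟨i, by simp [hi, hci]⟩
  simp only [Finset.mem_filter] at hi0 hmax
  apply h i0
  rw [← Finset.add_sum_erase s _ hi0.1] at hc
  have h1 : u i0 = (c i0)⁻¹ • (-∑ x ∈ s.erase i0, c x • u x) := by
    rw [← eq_neg_of_add_eq_zero_left hc, smul_smul, inv_mul_cancel₀ hi0.2, one_smul]
  rw [h1]
  refine Submodule.smul_mem _ _ (Submodule.neg_mem _ (Submodule.sum_mem _ fun j hj => ?_))
  by_cases hcj : c j = 0
  · simp [hcj]
  refine Submodule.smul_mem _ _ (Submodule.subset_span ⟨j, ?_, rfl⟩)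
  rw [Finset.mem_erase] at hj
  exact lt_of_le_of_ne (hmax j ⟨hj.2, hcj⟩) fun h => hj.1 (hg h)

def goodWords {k : ℕ} (E : Fin k → Fin k → Prop) [DecidableRel E] : ℕ → Fin k → Finset (List (Fin k))
  | 0, i => {[i]}
  | n + 1, i => (Finset.univ.filter (fun j => E i j)).biUnion
      (fun j => (goodWords E n j).image (fun w => i :: w))

theorem mem_goodWords {k : ℕ} (E : Fin k → Fin k → Prop) [DecidableRel E] (w : List (Fin k)) :
    ∀ i, List.IsChain E (i :: w) → i :: w ∈ goodWords E w.length i := by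
  induction w with
  | nil => intro i _; simp [goodWords]
  | cons j w ih =>
    intro i h
    rw [List.isChain_cons_cons] at h
    simp only [goodWords, List.length_cons, Finset.mem_biUnion, Finset.mem_filter,
      Finset.mem_univ, true_and, Finset.mem_image]
    exact ⟨j, h.1, _, ih j h.2, rfl⟩

theorem card_goodWords {k : ℕ} (E : Fin k → Fin k → Prop) [DecidableRel E] (x : Fin k → ℝ) (s C : ℝ)
    (hs : 0 ≤ s) (hC : 0 ≤ C) (hx : ∀ i, ∑ j, (if E i j then (1:ℝ) else 0) * x j ≤ s * x i)
    (hCx : ∀ i, 1 ≤ C * x i) (n : ℕ) : ∀ i, ((goodWords E n i).card : ℝ) ≤ C * s ^ n * x i := by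
  induction n with
  | zero => intro i; simpa [goodWords] using hCx i
  | succ n ih =>
    intro i
    have h1 : (goodWords E (n+1) i).card ≤ ∑ j ∈ Finset.univ.filter (fun j => E i j), (goodWords E n j).card :=
      Finset.card_biUnion_le.trans (Finset.sum_le_sum fun j _ => Finset.card_image_le)
    calc ((goodWords E (n+1) i).card : ℝ) ≤ ((∑ j ∈ Finset.univ.filter (fun j => E i j), (goodWords E n j).card : ℕ) : ℝ) := by
          exact_mod_cast h1
      _ ≤ ∑ j ∈ Finset.univ.filter (fun j => E i j), C * s ^ n * x j := by
          push_cast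
          exact Finset.sum_le_sum fun j _ => ih j
      _ = C * s ^ n * ∑ j, (if E i j then (1:ℝ) else 0) * x j := by
          rw [Finset.sum_filter, Finset.mul_sum]
          refine Finset.sum_congr rfl fun j _ => ?_
          split_ifs <;> simp
      _ ≤ C * s ^ n * (s * x i) := mul_le_mul_of_nonneg_left (hx i) (by positivity)
      _ = _ := by ring

def wt {k : ℕ} : List (Fin k) → ℕ
  | [] => 0
  | i :: w => (i : ℕ) * k ^ w.length + wt w

theorem wt_lt {k : ℕ} (a b : List (Fin k)) (i j p q : Fin k)
    (h : (p : ℕ) * k + q < (i : ℕ) * k + j) : wt (a ++ p :: q :: b) < wt (a ++ i :: j :: b) := by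
  induction a with
  | nil =>
    have hk : 0 < k ^ b.length := pow_pos (Fin.pos i) _
    simp only [List.nil_append, wt, List.length_cons, pow_succ]
    nlinarith
  | cons c a ih =>
    simp only [List.cons_append, wt, List.length_append, List.length_cons]
    omega

theorem words_span {F A : Type*} [Field F] [Ring A] [Algebra F A] {k : ℕ} (x : Fin k → A)
    (E : Fin k → Fin k → Prop)
    (hE : ∀ i j, ¬ E i j → x i * x j ∈ Submodule.span F
      ((fun p : Fin k × Fin k => x p.1 * x p.2) '' {p | (p.1 : ℕ) * k + p.2 < (i : ℕ) * k + j}))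
    (N : ℕ) : ∀ w : List (Fin k), wt w = N → (w.map x).prod ∈
      Submodule.span F ((fun v : List (Fin k) => (v.map x).prod) '' {v | List.IsChain E v ∧ v.length = w.length}) := by
  induction N using Nat.strong_induction_on with
  | _ N ih =>
  intro w hw
  by_cases hch : List.IsChain E w
  · exact Submodule.subset_span ⟨w, ⟨hch, rfl⟩, rfl⟩
  rw [List.isChain_iff_forall_rel_of_append_cons_cons] at hch
  push Not at hch
  obtain ⟨i, j, a, b, rfl, hij⟩ := hch
  have h1 := hE i j hij
  let f : A →ₗ[F] A := (LinearMap.mulLeft F (a.map x).prod).comp (LinearMap.mulRight F (b.map x).prod)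
  have hf : ∀ p q, f (x p * x q) = ((a ++ p :: q :: b).map x).prod := by
    intro p q; simp [f, mul_assoc]
  rw [← hf]
  have h2 := Submodule.mem_map_of_mem (f := f) h1
  rw [Submodule.map_span] at h2
  refine Submodule.span_le.2 ?_ h2
  rintro _ ⟨_, ⟨⟨p, q⟩, hpq, rfl⟩, rfl⟩
  simp only [hf]
  have := ih _ (hw ▸ wt_lt a b i j p q hpq) (a ++ p :: q :: b) rfl
  simpa using this

theorem graded_span {F A : Type*} [Field F] [Ring A] [Algebra F A] {k : ℕ} (x : Fin k → A)
    (𝒜 : ℕ → Submodule F A)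
    (hconn : 𝒜 0 = (1 : Submodule F A))
    (hgen : ∀ n, 𝒜 (n + 1) = 𝒜 1 * 𝒜 n) (hx : 𝒜 1 = Submodule.span F (Set.range x)) (n : ℕ) :
    𝒜 n = Submodule.span F ((fun v : List (Fin k) => (v.map x).prod) '' {v | v.length = n}) := by
  induction n with
  | zero =>
    rw [hconn, Submodule.one_eq_span]
    congr 1
    ext y; simp
  | succ n ih =>
    rw [hgen, ih, hx, Submodule.span_mul_span]
    congr 1
    ext y
    constructor
    · rintro ⟨_, ⟨i, rfl⟩, _, ⟨v, hv, rfl⟩, rfl⟩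
      exact ⟨i :: v, by simpa using hv, by simp⟩
    · rintro ⟨v, hv, rfl⟩
      cases v with
      | nil => simp at hv
      | cons i v => exact ⟨_, ⟨i, rfl⟩, _, ⟨v, by simpa using hv, rfl⟩, by simp⟩

/-- If `A` is a connected graded algebra over a field generated in degree 1 with finite
dimensional components and `dim A₂ = m² + 1`, then the entropy
`H(A) = lim (dim Aₙ)^(1/n)` satisfies `H(A) ≤ m`. -/
theorem entropy_le_of_dim_two (F : Type*) [Field F] (A : Type*) [Ring A] [Algebra F A]
    (𝒜 : ℕ → Submodule F A) [GradedAlgebra 𝒜]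
    (hconn : 𝒜 0 = (1 : Submodule F A))
    (hgen : ∀ n, 𝒜 (n + 1) = 𝒜 1 * 𝒜 n)
    (hfin : ∀ n, Module.Finite F (𝒜 n))
    (m : ℕ) (hm : 1 ≤ m) (hdim2 : finrank F (𝒜 2) = m ^ 2 + 1)
    (H : ℝ)
    (hH : Tendsto (fun n => (finrank F (𝒜 n) : ℝ) ^ (1 / (n : ℝ))) atTop (nhds H)) :
    H ≤ (m : ℝ) := by
  classical
  have := hfin 1
  have hfin2 := hfin 2
  set k := finrank F (𝒜 1) with hk
  let bs : Basis (Fin k) F (𝒜 1) := finBasis F (𝒜 1)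
  let x : Fin k → A := fun i => (bs i : A)
  have hx : 𝒜 1 = Submodule.span F (Set.range x) := by
    have h1 := congrArg (Submodule.map (𝒜 1).subtype) bs.span_eq
    rw [Submodule.map_span, Submodule.map_top, Submodule.range_subtype, ← Set.range_comp] at h1
    exact h1.symm
  have hspan := graded_span x 𝒜 hconn hgen hx
  let u : Fin k × Fin k → A := fun p => x p.1 * x p.2
  let g : Fin k × Fin k → ℕ := fun p => (p.1 : ℕ) * k + p.2
  have hg : Function.Injective g := by
    rintro ⟨p, q⟩ ⟨p', q'⟩ h
    have hk0 : 0 < k := Fin.pos p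
    simp only [g] at h
    have h1 : (p : ℕ) = p' := by
      have e1 : ((p : ℕ) * k + q) / k = p := by
        rw [mul_comm, Nat.mul_add_div hk0, Nat.div_eq_of_lt q.2, add_zero]
      have e2 : ((p' : ℕ) * k + q') / k = p' := by
        rw [mul_comm, Nat.mul_add_div hk0, Nat.div_eq_of_lt q'.2, add_zero]
      rw [← e1, ← e2, h]
    rw [h1] at h
    have h2 : (q : ℕ) = q' := by omega
    exact Prod.ext (Fin.ext h1) (Fin.ext h2)
  let E : Fin k → Fin k → Prop := fun i j =>
    u (i, j) ∉ Submodule.span F (u '' {p | g p < g (i, j)})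
  have hcard : ∑ i, ∑ j, (if E i j then (1:ℤ) else 0) ≤ m ^ 2 + 1 := by
    have hmem : ∀ p, u p ∈ 𝒜 2 := by
      intro p
      rw [hgen 1]
      exact Submodule.mul_mem_mul (bs p.1).2 (bs p.2).2
    let ι := {p : Fin k × Fin k // E p.1 p.2}
    have hli : LinearIndependent F (fun p : ι => u p.1) := by
      refine linIndep_of_key _ (fun p : ι => g p.1) (hg.comp Subtype.val_injective) ?_
      intro p hp
      refine p.2 (Submodule.span_mono ?_ hp)
      rintro _ ⟨q, hq, rfl⟩
      exact ⟨q.1, hq, rfl⟩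
    have hli2 : LinearIndependent F (fun p : ι => (⟨u p.1, hmem p.1⟩ : 𝒜 2)) :=
      LinearIndependent.of_comp (𝒜 2).subtype hli
    have := hli2.fintype_card_le_finrank
    rw [hdim2, Fintype.card_subtype] at this
    have h2 : ∑ i, ∑ j, (if E i j then (1:ℤ) else 0) =
        ((Finset.univ.filter (fun p : Fin k × Fin k => E p.1 p.2)).card : ℤ) := by
      rw [← Finset.sum_boole, Fintype.sum_prod_type]
    rw [h2]
    exact_mod_cast this
  refine le_of_forall_gt_imp_ge_of_dense fun s hs => ?_
  have hs0 : 0 < s := lt_of_le_of_lt (Nat.cast_nonneg m) hs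
  obtain ⟨z, hz0, hz⟩ := graph_supersol E m hm s hs hcard
  set C : ℝ := ∑ i, (z i)⁻¹ with hC
  have hC0 : 0 ≤ C := Finset.sum_nonneg fun i _ => (inv_pos.2 (hz0 i)).le
  have hCz : ∀ i, 1 ≤ C * z i := by
    intro i
    have h1 : (z i)⁻¹ ≤ C := Finset.single_le_sum (f := fun i => (z i)⁻¹)
      (fun i _ => (inv_pos.2 (hz0 i)).le) (Finset.mem_univ i)
    have := mul_le_mul_of_nonneg_right h1 (hz0 i).le
    rwa [inv_mul_cancel₀ (hz0 i).ne'] at this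
  have hcw := card_goodWords E z s C hs0.le hC0 hz hCz
  have hbound : ∀ n, (finrank F (𝒜 (n + 1)) : ℝ) ≤ (C * ∑ i, z i) * s ^ n := by
    intro n
    set G : Finset (List (Fin k)) := Finset.univ.biUnion (fun i => goodWords E n i) with hG
    have hle : 𝒜 (n + 1) ≤ Submodule.span F ((G.image (fun v => (v.map x).prod) : Finset A) : Set A) := by
      rw [hspan]
      refine Submodule.span_le.2 ?_
      rintro _ ⟨v, hv, rfl⟩
      have h1 := words_span (F := F) x E (fun i j h => not_not.1 h) _ v rfl
      refine Submodule.span_mono ?_ h1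
      rintro _ ⟨w, ⟨hw1, hw2⟩, rfl⟩
      rw [Finset.coe_image]
      refine ⟨w, ?_, rfl⟩
      cases w with
      | nil => simp at hv hw2; omega
      | cons i w =>
        have hl : w.length = n := by simp at hv hw2; omega
        have := mem_goodWords E w i hw1
        rw [hl] at this
        simp only [hG, Finset.coe_biUnion, Set.mem_iUnion]
        exact ⟨i, by simp, this⟩
    have h2 : finrank F (𝒜 (n + 1)) ≤ G.card :=
      (Submodule.finrank_mono hle).trans ((finrank_span_finset_le_card _).trans Finset.card_image_le)
    have h3 : G.card ≤ ∑ i, (goodWords E n i).card := Finset.card_biUnion_le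
    calc (finrank F (𝒜 (n + 1)) : ℝ) ≤ ((∑ i, (goodWords E n i).card : ℕ) : ℝ) := by
          exact_mod_cast h2.trans h3
      _ ≤ ∑ i, C * s ^ n * z i := by
          push_cast; exact Finset.sum_le_sum fun i _ => hcw n i
      _ = _ := by rw [← Finset.mul_sum]; ring
  set D : ℝ := (C * ∑ i, z i) / s + 1 with hD
  have hD0 : 0 < D := by
    have : 0 ≤ ∑ i, z i := Finset.sum_nonneg fun i _ => (hz0 i).le
    positivity
  have hlim : Tendsto (fun n : ℕ => D ^ (1 / (n : ℝ)) * s) atTop (nhds s) := by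
    have h1 : Tendsto (fun n : ℕ => D ^ (1 / (n : ℝ))) atTop (nhds (D ^ (0:ℝ))) :=
      tendsto_const_nhds.rpow tendsto_one_div_atTop_nhds_zero_nat (Or.inl hD0.ne')
    simpa using h1.mul_const s
  refine le_of_tendsto_of_tendsto hH hlim ?_
  filter_upwards [eventually_ge_atTop 1] with n hn
  obtain ⟨n, rfl⟩ : ∃ l, n = l + 1 := ⟨n - 1, by omega⟩
  have h1 : (finrank F (𝒜 (n + 1)) : ℝ) ≤ D * s ^ (n + 1) := by
    refine (hbound n).trans ?_
    have : (C * ∑ i, z i) * s ^ n = (C * ∑ i, z i) / s * s ^ (n + 1) := by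
      field_simp; ring
    rw [this]
    exact mul_le_mul_of_nonneg_right (by linarith) (by positivity)
  calc (finrank F (𝒜 (n + 1)) : ℝ) ^ (1 / ((n + 1 : ℕ) : ℝ)) ≤ (D * s ^ (n + 1)) ^ (1 / ((n + 1 : ℕ) : ℝ)) :=
        Real.rpow_le_rpow (Nat.cast_nonneg _) h1 (by positivity)
    _ = D ^ (1 / ((n + 1 : ℕ) : ℝ)) * s := by
        rw [Real.mul_rpow hD0.le (by positivity), one_div, Real.pow_rpow_inv_natCast hs0.le (by omega)]
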